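/- Let X be the conjugacy class of involutions in G_6 with labelled cycle type (1,2,1,1), i.e. n = 6, m = 1, k_e = 2, k_o = 1 and l = 1. Then Diam C(G_6,X) ≤ 6. -/

import Mathlib

/-!
Common setup: the affine Weyl group of type C̃ₙ, realized as the semidirect
product of the group Wₙ of signed permutations of {1,…,n} with the translation
lattice ℤⁿ.  An element is a triple `(π, s, v)`, where `π` is the underlying
permutation of the n points, `s i` is the sign attached to the point `i`
(so the signed permutation maps the point `i` to the point `π i` with sign `s i`),
and `v ∈ ℤⁿ` is the translation part.  The multiplication realizes
`(α,v)(τ,u) = (ατ, vᵗ + u)`.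
-/

/-- An element of the affine Weyl group of type C̃ₙ: a signed permutation
`(π, s)` together with a translation vector `v ∈ ℤⁿ`. -/
@[ext]
structure AffineWeylC (n : ℕ) where
  π : Equiv.Perm (Fin n)
  s : Fin n → ℤˣ
  v : Fin n → ℤ

namespace AffineWeylC

variable {n : ℕ}

instance : One (AffineWeylC n) := ⟨⟨1, 1, 0⟩⟩

instance : Mul (AffineWeylC n) :=
  ⟨fun g h => ⟨h.π * g.π, fun j => g.s j * h.s (g.π j),
    fun i => (h.s (h.π⁻¹ i) : ℤ) * g.v (h.π⁻¹ i) + h.v i⟩⟩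

instance : Inv (AffineWeylC n) :=
  ⟨fun g => ⟨g.π⁻¹, fun k => (g.s (g.π⁻¹ k))⁻¹,
    fun i => -(((g.s i)⁻¹ : ℤˣ) : ℤ) * g.v (g.π i)⟩⟩

@[simp] lemma mul_π (g h : AffineWeylC n) : (g * h).π = h.π * g.π := rfl
@[simp] lemma mul_s (g h : AffineWeylC n) (j : Fin n) :
    (g * h).s j = g.s j * h.s (g.π j) := rfl
@[simp] lemma mul_v (g h : AffineWeylC n) (i : Fin n) :
    (g * h).v i = (h.s (h.π⁻¹ i) : ℤ) * g.v (h.π⁻¹ i) + h.v i := rfl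
@[simp] lemma one_π : (1 : AffineWeylC n).π = 1 := rfl
@[simp] lemma one_s (j : Fin n) : (1 : AffineWeylC n).s j = 1 := rfl
@[simp] lemma one_v (i : Fin n) : (1 : AffineWeylC n).v i = 0 := rfl
@[simp] lemma inv_π (g : AffineWeylC n) : g⁻¹.π = g.π⁻¹ := rfl
@[simp] lemma inv_s (g : AffineWeylC n) (k : Fin n) :
    g⁻¹.s k = (g.s (g.π⁻¹ k))⁻¹ := rfl
@[simp] lemma inv_v (g : AffineWeylC n) (i : Fin n) :
    g⁻¹.v i = -(((g.s i)⁻¹ : ℤˣ) : ℤ) * g.v (g.π i) := rfl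

instance : Group (AffineWeylC n) where
  mul_assoc a b c := by
    refine AffineWeylC.ext ?_ (funext fun j => ?_) (funext fun i => ?_)
    · simp [mul_assoc]
    · simp only [mul_s, mul_π, Equiv.Perm.mul_apply]
      rw [mul_assoc]
    · have h0 : ∀ (e : Equiv.Perm (Fin n)) (x : Fin n), e (e⁻¹ x) = x :=
        fun e x => e.apply_symm_apply x
      simp only [mul_v, mul_s, mul_π, mul_inv_rev, Equiv.Perm.mul_apply,
        h0, Units.val_mul]
      ring
  one_mul a := by
    refine AffineWeylC.ext ?_ (funext fun j => ?_) (funext fun i => ?_) <;>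
      simp
  mul_one a := by
    refine AffineWeylC.ext ?_ (funext fun j => ?_) (funext fun i => ?_) <;>
      simp
  inv_mul_cancel a := by
    refine AffineWeylC.ext ?_ (funext fun j => ?_) (funext fun i => ?_)
    · simp
    · simp
    · have h0 : ∀ (e : Equiv.Perm (Fin n)) (x : Fin n), e (e⁻¹ x) = x :=
        fun e x => e.apply_symm_apply x
      simp only [mul_v, inv_v, inv_s, one_v, h0]
      have h1 : ((a.s (a.π⁻¹ i) : ℤ)) * (((a.s (a.π⁻¹ i))⁻¹ : ℤˣ) : ℤ) = 1 := by
        rw [← Units.val_mul, mul_inv_cancel, Units.val_one]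
      linear_combination (-(a.v i)) * h1

/-- `g` is an involution: a non-identity element squaring to the identity. -/
def Involution (g : AffineWeylC n) : Prop := g ≠ 1 ∧ g * g = 1

/-- The conjugacy class of `a`. -/
def conjClass (a : AffineWeylC n) : Set (AffineWeylC n) := {b | IsConj a b}

/-- The number of transpositions (2-cycles) of the underlying signed permutation. -/
noncomputable def numTrans (g : AffineWeylC n) : ℕ :=
  {i : Fin n | g.π i ≠ i}.ncard / 2

/-- The number of negative 1-cycles of `g` carrying an even label. -/
noncomputable def numNegEven (g : AffineWeylC n) : ℕ :=
  {i : Fin n | g.π i = i ∧ g.s i = -1 ∧ Even (g.v i)}.ncard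

/-- The number of negative 1-cycles of `g` carrying an odd label. -/
noncomputable def numNegOdd (g : AffineWeylC n) : ℕ :=
  {i : Fin n | g.π i = i ∧ g.s i = -1 ∧ Odd (g.v i)}.ncard

/-- The number of positive 1-cycles (fixed points) of `g`. -/
noncomputable def numPos (g : AffineWeylC n) : ℕ :=
  {i : Fin n | g.π i = i ∧ g.s i = 1}.ncard

/-- The labelled cycle type `(m, k_e, k_o, l)` of an involution. -/
noncomputable def cycleType (g : AffineWeylC n) : ℕ × ℕ × ℕ × ℕ :=
  (numTrans g, numNegEven g, numNegOdd g, numPos g)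

/-- `g` has labelled cycle type `(m, k_e, k_o, l)`. -/
def HasType (g : AffineWeylC n) (m ke ko l : ℕ) : Prop :=
  numTrans g = m ∧ numNegEven g = ke ∧ numNegOdd g = ko ∧ numPos g = l

/-- The canonical class representative
`a_{m,k_e,k_o,l} = (1 2)⁺₀ ⋯ (2m−1 2m)⁺₀ (2m+1)⁻₀ ⋯ (2m+k_e)⁻₀
(2m+k_e+1)⁻₁ ⋯ (n−l)⁻₁ (n−l+1)⁺₀ ⋯ (n)⁺₀`
(here written with 0-based indices): points `0,…,2m-1` are paired off into
label‑0 positive transpositions, points `2m,…,2m+k_e-1` are negative 1-cycles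
with label 0, points `2m+k_e,…,2m+k_e+k_o-1` are negative 1-cycles with label 1,
and the remaining `l` points are positive fixed points with label 0. -/
def IsCanon (a : AffineWeylC n) (m ke ko l : ℕ) : Prop :=
  2*m + ke + ko + l = n ∧
  (∀ i : Fin n, i.val < 2*m → i.val % 2 = 0 → (a.π i).val = i.val + 1) ∧
  (∀ i : Fin n, i.val < 2*m → i.val % 2 = 1 → (a.π i).val = i.val - 1) ∧
  (∀ i : Fin n, 2*m ≤ i.val → a.π i = i) ∧
  (∀ i : Fin n, i.val < 2*m → a.s i = 1 ∧ a.v i = 0) ∧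
  (∀ i : Fin n, 2*m ≤ i.val → i.val < 2*m + ke → a.s i = -1 ∧ a.v i = 0) ∧
  (∀ i : Fin n, 2*m + ke ≤ i.val → i.val < 2*m + ke + ko → a.s i = -1 ∧ a.v i = 1) ∧
  (∀ i : Fin n, 2*m + ke + ko ≤ i.val → a.s i = 1 ∧ a.v i = 0)

/-- The labelled positive transposition `(α β)⁺_λ`. -/
def posTrans (α β : Fin n) (lam : ℤ) : AffineWeylC n :=
  ⟨Equiv.swap α β, 1, fun i => if i = α then lam else if i = β then -lam else 0⟩

/-- The labelled negative transposition `(α β)⁻_λ`. -/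
def negTrans (α β : Fin n) (lam : ℤ) : AffineWeylC n :=
  ⟨Equiv.swap α β, fun i => if i = α then -1 else if i = β then -1 else 1,
    fun i => if i = α then lam else if i = β then lam else 0⟩

/-- The labelled negative 1-cycle `(α)⁻_λ`. -/
def negOne (α : Fin n) (lam : ℤ) : AffineWeylC n :=
  ⟨1, fun i => if i = α then -1 else 1, fun i => if i = α then lam else 0⟩

/-- The finite Weyl group Wₙ of type Cₙ, as the subgroup of the affine Weyl
group consisting of the elements with trivial translation part. -/
def WeylSub (n : ℕ) : Subgroup (AffineWeylC n) where
  carrier := {g | g.v = 0}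
  one_mem' := rfl
  mul_mem' := by
    intro g h hg hh
    show (g * h).v = 0
    funext i
    simp only [mul_v]
    rw [show g.v = 0 from hg, show h.v = 0 from hh]
    simp
  inv_mem' := by
    intro g hg
    show g⁻¹.v = 0
    funext i
    simp only [inv_v]
    rw [show g.v = 0 from hg]
    simp

/-- The projection `G_n → W_n`, `(σ, v) ↦ σ`. -/
def weylPart (n : ℕ) : AffineWeylC n →* WeylSub n where
  toFun g := ⟨⟨g.π, g.s, 0⟩, rfl⟩
  map_one' := by
    apply Subtype.ext
    refine AffineWeylC.ext rfl rfl rfl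
  map_mul' g h := by
    apply Subtype.ext
    refine AffineWeylC.ext rfl rfl (funext fun i => ?_)
    simp

end AffineWeylC

/-- The commuting graph on a subset `X` of a group: the vertices are the
elements of `X`, and distinct vertices are adjacent iff they commute. -/
def commGraph {G : Type*} [Group G] (X : Set G) : SimpleGraph X where
  Adj x y := (x : G) ≠ (y : G) ∧ Commute (x : G) (y : G)
  symm := ⟨fun _ _ h => ⟨fun e => h.1 e.symm, h.2.symm⟩⟩
  loopless := ⟨fun _ h => h.1 rfl⟩

namespace AffineWeylC

/-- The involution with transposition `{σ 0, σ 1}` of sign `ε` and label `t`, negative 1-cycles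
`σ 2`, `σ 3`, `σ 4` with labels `2p`, `2q`, `2r + 1`, and positive 1-cycle `σ 5`. -/
def ofData (σ : Equiv.Perm (Fin 6)) (ε : ℤˣ) (t p q r : ℤ) : AffineWeylC 6 :=
  ⟨Equiv.swap (σ 0) (σ 1), fun i => ![ε, ε, -1, -1, -1, 1] (σ⁻¹ i),
    fun i => ![t, -(ε * t), 2 * p, 2 * q, 2 * r + 1, 0] (σ⁻¹ i)⟩

lemma ext_comp {g h : AffineWeylC 6} (σ : Equiv.Perm (Fin 6))
    (hπ : ∀ i, g.π (σ i) = h.π (σ i)) (hs : ∀ i, g.s (σ i) = h.s (σ i))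
    (hv : ∀ i, g.v (σ i) = h.v (σ i)) : g = h := by
  refine AffineWeylC.ext (Equiv.ext fun i => ?_) (funext fun i => ?_) (funext fun i => ?_)
  · simpa using hπ (σ.symm i)
  · simpa using hs (σ.symm i)
  · simpa using hv (σ.symm i)

/-- The signed permutation with all signs positive and no translation part. -/
def ofPerm (σ : Equiv.Perm (Fin 6)) : AffineWeylC 6 := ⟨σ, 1, 0⟩

lemma ofData_mul (σ τ : Equiv.Perm (Fin 6)) (ε : ℤˣ) (t p q r : ℤ) :
    ofData (σ * τ) ε t p q r = (ofPerm σ)⁻¹ * ofData τ ε t p q r * ofPerm σ := by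
  rw [mul_assoc, eq_inv_mul_iff_mul_eq]
  refine AffineWeylC.ext ?_ (funext fun i => ?_) (funext fun i => ?_)
  · simp only [ofData, ofPerm, mul_π, Equiv.Perm.mul_apply]
    exact (Equiv.mul_swap_eq_swap_mul σ (τ 0) (τ 1)).symm
  · simp [ofData, ofPerm]
  · simp [ofData, ofPerm]

lemma commute_ofData_of_one {σ τ : Equiv.Perm (Fin 6)} {ε t p q r ε' t' p' q' r'}
    (h : Commute (ofData 1 ε t p q r) (ofData τ ε' t' p' q' r')) :
    Commute (ofData σ ε t p q r) (ofData (σ * τ) ε' t' p' q' r') := by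
  have h1 := ofData_mul σ 1 ε t p q r
  rw [mul_one] at h1
  rw [h1, ofData_mul]
  have h2 := (SemiconjBy.conj_iff (a := ofData 1 ε t p q r) (x := ofData τ ε' t' p' q' r')
    (y := ofData τ ε' t' p' q' r') (b := (ofPerm σ)⁻¹)).2 h
  simpa [Commute] using h2

lemma ofData_swap_zero_one (σ : Equiv.Perm (Fin 6)) (ε : ℤˣ) (t p q r : ℤ) :
    ofData (σ * Equiv.swap 0 1) ε (-(ε * t)) p q r = ofData σ ε t p q r := by
  have h : ofData (Equiv.swap 0 1) ε (-(ε * t)) p q r = ofData 1 ε t p q r := by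
    refine ext_comp 1 (fun i => ?_) (fun i => ?_) (fun i => ?_) <;>
    rcases Int.units_eq_one_or ε with rfl | rfl <;> fin_cases i <;>
    simp [ofData, Equiv.swap_apply_def]
  rw [ofData_mul, h, ← ofData_mul, mul_one]

lemma ofData_swap_two_three (σ : Equiv.Perm (Fin 6)) (ε : ℤˣ) (t p q r : ℤ) :
    ofData (σ * Equiv.swap 2 3) ε t q p r = ofData σ ε t p q r := by
  have h : ofData (Equiv.swap 2 3) ε t q p r = ofData 1 ε t p q r := by
    refine ext_comp 1 (fun i => ?_) (fun i => ?_) (fun i => ?_) <;> fin_cases i <;>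
    simp [ofData, Equiv.swap_apply_def]
  rw [ofData_mul, h, ← ofData_mul, mul_one]

/-- Interchanges the transposition with the two even negative 1-cycles. -/
def pairSwap : Equiv.Perm (Fin 6) := Equiv.swap 0 2 * Equiv.swap 1 3

lemma commute_ofData_swap_two_five (σ : Equiv.Perm (Fin 6)) {ε ε' : ℤˣ} {t t' : ℤ}
    (p p' q r : ℤ) (h : ε' = ε → t' = t) :
    Commute (ofData σ ε t p q r) (ofData (σ * Equiv.swap 2 5) ε' t' p' q r) := by
  refine commute_ofData_of_one (ext_comp 1 (fun i => ?_) (fun i => ?_) (fun i => ?_)) <;>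
  rcases Int.units_eq_one_or ε with rfl | rfl <;>
  rcases Int.units_eq_one_or ε' with rfl | rfl <;> simp at h <;> fin_cases i <;>
  simp [ofData, Equiv.swap_apply_def, h, add_comm]

lemma commute_ofData_swap_three_five (σ : Equiv.Perm (Fin 6)) {ε ε' : ℤˣ} {t t' : ℤ}
    (p q q' r : ℤ) (h : ε' = ε → t' = t) :
    Commute (ofData σ ε t p q r) (ofData (σ * Equiv.swap 3 5) ε' t' p q' r) := by
  refine commute_ofData_of_one (ext_comp 1 (fun i => ?_) (fun i => ?_) (fun i => ?_)) <;>
  rcases Int.units_eq_one_or ε with rfl | rfl <;>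
  rcases Int.units_eq_one_or ε' with rfl | rfl <;> simp at h <;> fin_cases i <;>
  simp [ofData, Equiv.swap_apply_def, h, add_comm]

lemma commute_ofData_swap_four_five (σ : Equiv.Perm (Fin 6)) {ε ε' : ℤˣ} {t t' : ℤ}
    (p q r r' : ℤ) (h : ε' = ε → t' = t) :
    Commute (ofData σ ε t p q r) (ofData (σ * Equiv.swap 4 5) ε' t' p q r') := by
  refine commute_ofData_of_one (ext_comp 1 (fun i => ?_) (fun i => ?_) (fun i => ?_)) <;>
  rcases Int.units_eq_one_or ε with rfl | rfl <;>
  rcases Int.units_eq_one_or ε' with rfl | rfl <;> simp at h <;> fin_cases i <;>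
  simp [ofData, Equiv.swap_apply_def, h, add_comm]

lemma commute_ofData_pairSwap (σ : Equiv.Perm (Fin 6)) {ε ε' : ℤˣ} {t t' p p' q q' : ℤ} (r : ℤ)
    (h : t = p' - ε * q') (h' : t' = p - ε' * q) :
    Commute (ofData σ ε t p q r) (ofData (σ * pairSwap) ε' t' p' q' r) := by
  subst h h'
  refine commute_ofData_of_one (ext_comp 1 (fun i => ?_) (fun i => ?_) (fun i => ?_)) <;>
  rcases Int.units_eq_one_or ε with rfl | rfl <;>
  rcases Int.units_eq_one_or ε' with rfl | rfl <;> fin_cases i <;>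
  simp [ofData, pairSwap, Equiv.swap_apply_def] <;> ring

lemma commute_ofData_pairSwap_swap (σ : Equiv.Perm (Fin 6)) {ε ε' : ℤˣ} {t t' p p' q q' : ℤ}
    (r r' : ℤ) (h : t = p' - ε * q') (h' : t' = p - ε' * q) :
    Commute (ofData σ ε t p q r)
      (ofData (σ * (pairSwap * Equiv.swap 4 5)) ε' t' p' q' r') := by
  subst h h'
  refine commute_ofData_of_one (ext_comp 1 (fun i => ?_) (fun i => ?_) (fun i => ?_)) <;>
  rcases Int.units_eq_one_or ε with rfl | rfl <;>
  rcases Int.units_eq_one_or ε' with rfl | rfl <;> fin_cases i <;>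
  simp [ofData, pairSwap, Equiv.swap_apply_def] <;> ring


/-- The involutions of labelled cycle type `(1, 2, 1, 1)`. -/
def dataSet : Set (AffineWeylC 6) := {b | ∃ σ ε t p q r, b = ofData σ ε t p q r}

lemma ofData_mem (σ : Equiv.Perm (Fin 6)) (ε : ℤˣ) (t p q r : ℤ) :
    ofData σ ε t p q r ∈ dataSet := ⟨σ, ε, t, p, q, r, rfl⟩

lemma isConj_ofData (σ : Equiv.Perm (Fin 6)) (ε : ℤˣ) (t p q r : ℤ) :
    IsConj (ofData 1 1 0 0 0 0) (ofData σ ε t p q r) := by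
  let g : AffineWeylC 6 := ⟨σ, ![ε, 1, 1, 1, 1, 1], fun i => ![t, 0, p, q, r, 0] (σ⁻¹ i)⟩
  refine isConj_iff.2 ⟨g⁻¹, ?_⟩
  rw [inv_inv, mul_assoc, inv_mul_eq_iff_eq_mul]
  refine AffineWeylC.ext ?_ (funext fun i => ?_) (funext fun i => ?_)
  · exact Equiv.mul_swap_eq_swap_mul σ 0 1
  · rcases Int.units_eq_one_or ε with rfl | rfl <;> fin_cases i <;>
    simp [ofData, g, Equiv.swap_apply_def]
  · obtain ⟨i, rfl⟩ := σ.surjective i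
    rcases Int.units_eq_one_or ε with rfl | rfl <;> fin_cases i <;>
    simp [ofData, g, Equiv.swap_apply_def] <;> ring

lemma mem_dataSet_of_isConj {b : AffineWeylC 6} (h : IsConj (ofData 1 1 0 0 0 0) b) :
    b ∈ dataSet := by
  obtain ⟨c, hc⟩ := isConj_iff.1 h
  obtain ⟨⟨σ, s, v⟩, rfl⟩ : ∃ g, c = g⁻¹ := ⟨c⁻¹, by simp⟩
  refine ⟨σ, s 0 * s 1, v (σ 0) - s 0 * s 1 * v (σ 1), v (σ 2), v (σ 3),
    if s 4 = 1 then v (σ 4) else v (σ 4) - 1, ?_⟩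
  rw [← hc, inv_inv, mul_assoc, inv_mul_eq_iff_eq_mul]
  refine AffineWeylC.ext ?_ (funext fun i => ?_) (funext fun i => ?_)
  · exact Equiv.mul_swap_eq_swap_mul σ 0 1
  · have h0 := Int.units_mul_self (s 0)
    have h1 := Int.units_mul_self (s 1)
    fin_cases i <;> simp [ofData, Equiv.swap_apply_def, ← mul_assoc, h0,
      mul_comm (s 1), mul_assoc (s 0), h1]
  · obtain ⟨i, rfl⟩ := σ.surjective i
    rcases Int.units_eq_one_or (s 0) with h0 | h0 <;>
    rcases Int.units_eq_one_or (s 1) with h1 | h1 <;>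
    rcases Int.units_eq_one_or (s 4) with h4 | h4 <;> fin_cases i <;>
    simp [ofData, Equiv.swap_apply_def, h0, h1, h4] <;> ring

lemma conjClass_ofData (σ : Equiv.Perm (Fin 6)) (ε : ℤˣ) (t p q r : ℤ) :
    conjClass (ofData σ ε t p q r) = dataSet := by
  ext b
  constructor
  · intro h
    exact mem_dataSet_of_isConj ((isConj_ofData σ ε t p q r).trans h)
  · rintro ⟨σ', ε', t', p', q', r', rfl⟩
    exact (isConj_ofData σ ε t p q r).symm.trans (isConj_ofData σ' ε' t' p' q' r')

lemma mem_dataSet_of_hasType {a : AffineWeylC 6} (ha : a.Involution) (h : a.HasType 1 2 1 1) :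
    a ∈ dataSet := by
  obtain ⟨hm, he, ho, hl⟩ := h
  obtain ⟨k, l, hkl, hE⟩ := Set.ncard_eq_two.1 he
  obtain ⟨o, hO⟩ := Set.ncard_eq_one.1 ho
  obtain ⟨f, hF⟩ := Set.ncard_eq_one.1 hl
  obtain ⟨i, hi⟩ : {i : Fin 6 | a.π i ≠ i}.Nonempty := by
    rw [Set.nonempty_iff_ne_empty]
    intro h0
    simp [numTrans, h0] at hm
  have hk : k ∈ ({k, l} : Set (Fin 6)) := by simp
  have hl₂ : l ∈ ({k, l} : Set (Fin 6)) := by simp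
  have ho' : o ∈ ({o} : Set (Fin 6)) := by simp
  have hf : f ∈ ({f} : Set (Fin 6)) := by simp
  rw [← hE] at hk hl₂
  rw [← hO] at ho'
  rw [← hF] at hf
  obtain ⟨hk1, hk2, p, hk3⟩ := hk
  obtain ⟨hl1, hl2, q, hl3⟩ := hl₂
  obtain ⟨ho1, ho2, r, ho3⟩ := ho'
  obtain ⟨hf1, hf2⟩ := hf
  have hi' : a.π i ≠ i := hi
  have hπ : ∀ j, a.π (a.π j) = j := fun j => by
    simpa using congrArg (fun g => g.π j) ha.2
  have hs : ∀ j, a.s j * a.s (a.π j) = 1 := fun j => by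
    simpa using congrArg (fun g => g.s j) ha.2
  have hv : ∀ j, (a.s j : ℤ) * a.v j + a.v (a.π j) = 0 := fun j => by
    simpa using congrArg (fun g => g.v (a.π j)) ha.2
  have hinj : Function.Injective ![i, a.π i, k, l, o, f] := by
    have e1 : k ≠ o := by rintro rfl; omega
    have e2 : l ≠ o := by rintro rfl; omega
    have e3 : ∀ j, a.s j = -1 → j ≠ f := by
      rintro j hj rfl
      rw [hf2] at hj
      exact absurd hj (by decide)
    have e4 : ∀ j, a.π j = j → i ≠ j := by rintro j hj rfl; exact hi' hj
    have e5 : ∀ j, a.π j = j → a.π i ≠ j := by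
      rintro j hj rfl
      exact hi' (by rw [hπ] at hj; exact hj.symm)
    rw [← List.nodup_ofFn]
    simp [hi'.symm, e1, e2, hkl, e3 _ hk2, e3 _ hl2, e3 _ ho2, e4 _ hk1, e4 _ hl1, e4 _ ho1,
      e4 _ hf1, e5 _ hk1, e5 _ hl1, e5 _ ho1, e5 _ hf1]
  let σ : Equiv.Perm (Fin 6) := Equiv.ofBijective _ (Finite.injective_iff_bijective.1 hinj)
  have s0 : σ 0 = i := rfl
  have s1 : σ 1 = a.π i := rfl
  have s2 : σ 2 = k := rfl
  have s3 : σ 3 = l := rfl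
  have s4 : σ 4 = o := rfl
  have s5 : σ 5 = f := rfl
  have hσ : ∀ j, σ⁻¹ (σ j) = j := σ.symm_apply_apply
  have hsi : a.s (a.π i) = a.s i := by
    rw [← mul_right_inj (a.s i), hs, Int.units_mul_self]
  have hvi : a.v (a.π i) = -(a.s i * a.v i) := by linarith [hv i]
  have hvf : a.v f = 0 := by
    have := hv f
    rw [hf1, hf2] at this
    simp at this
    omega
  have hswap : ∀ j, j ≠ 0 → j ≠ 1 → Equiv.swap (σ 0) (σ 1) (σ j) = σ j := fun j h0 h1 =>
    Equiv.swap_apply_of_ne_of_ne (σ.injective.ne h0) (σ.injective.ne h1)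
  refine ⟨σ, a.s i, a.v i, p, q, r, ext_comp σ (fun j => ?_) (fun j => ?_) (fun j => ?_)⟩
  · fin_cases j
    · simp [ofData, s0, s1]
    · simp [ofData, s0, s1, hπ]
    · exact (s2 ▸ hk1).trans (hswap 2 (by decide) (by decide)).symm
    · exact (s3 ▸ hl1).trans (hswap 3 (by decide) (by decide)).symm
    · exact (s4 ▸ ho1).trans (hswap 4 (by decide) (by decide)).symm
    · exact (s5 ▸ hf1).trans (hswap 5 (by decide) (by decide)).symm
  · simp only [ofData, hσ]
    fin_cases j <;> simp [s0, s1, s2, s3, s4, s5, hsi, hk2, hl2, ho2, hf2]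
  · simp only [ofData, hσ]
    fin_cases j <;> simp [s0, s1, s2, s3, s4, s5, hvi, hvf, hk3, hl3, ho3] <;> ring


/-- The vertex of the commuting graph on `dataSet` given by `ofData`. -/
def vertex (σ : Equiv.Perm (Fin 6)) (ε : ℤˣ) (t p q r : ℤ) : dataSet :=
  ⟨ofData σ ε t p q r, ofData_mem σ ε t p q r⟩

/-- Rearranging the points by `τ`, with arbitrary new sign and labels, takes at most `n` steps in
the commuting graph. -/
def Within (n : ℕ) (τ : Equiv.Perm (Fin 6)) : Prop :=
  ∀ σ ε t p q r ε' t' p' q' r',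
    (commGraph dataSet).edist (vertex σ ε t p q r) (vertex (σ * τ) ε' t' p' q' r') ≤ n

lemma edist_le_one {x y : dataSet} (h : Commute (x : AffineWeylC 6) y) :
    (commGraph dataSet).edist x y ≤ 1 := by
  rw [SimpleGraph.edist_le_one_iff_adj_or_eq]
  by_cases hxy : x = y
  · exact Or.inr hxy
  · exact Or.inl ⟨fun e => hxy (Subtype.ext e), h⟩

lemma edist_le_three {x y z w : dataSet} (h₁ : Commute (x : AffineWeylC 6) y)
    (h₂ : Commute (y : AffineWeylC 6) z) (h₃ : Commute (z : AffineWeylC 6) w) :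
    (commGraph dataSet).edist x w ≤ (3 : ℕ) := by
  have h := (SimpleGraph.edist_triangle (v := z)).trans
    (add_le_add ((SimpleGraph.edist_triangle (v := y)).trans
      (add_le_add (edist_le_one h₁) (edist_le_one h₂))) (edist_le_one h₃))
  exact h.trans (by norm_num)

lemma Within.mul_left_swap_zero_one {n : ℕ} {τ : Equiv.Perm (Fin 6)} (h : Within n τ) :
    Within n (Equiv.swap 0 1 * τ) := by
  intro σ ε t p q r ε' t' p' q' r'
  have := h (σ * Equiv.swap 0 1) ε (-(ε * t)) p q r ε' t' p' q' r'
  simpa only [vertex, ofData_swap_zero_one, mul_assoc] using this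

lemma Within.mul_left_swap_two_three {n : ℕ} {τ : Equiv.Perm (Fin 6)} (h : Within n τ) :
    Within n (Equiv.swap 2 3 * τ) := by
  intro σ ε t p q r ε' t' p' q' r'
  have := h (σ * Equiv.swap 2 3) ε t q p r ε' t' p' q' r'
  simpa only [vertex, ofData_swap_two_three, mul_assoc] using this

lemma Within.of_mul_swap_zero_one {n : ℕ} {τ : Equiv.Perm (Fin 6)}
    (h : Within n (τ * Equiv.swap 0 1)) : Within n τ := by
  intro σ ε t p q r ε' t' p' q' r'
  have := h σ ε t p q r ε' (-(ε' * t')) p' q' r'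
  simpa only [vertex, ← mul_assoc, ofData_swap_zero_one] using this

lemma Within.of_mul_swap_two_three {n : ℕ} {τ : Equiv.Perm (Fin 6)}
    (h : Within n (τ * Equiv.swap 2 3)) : Within n τ := by
  intro σ ε t p q r ε' t' p' q' r'
  have := h σ ε t p q r ε' t' q' p' r'
  simpa only [vertex, ← mul_assoc, ofData_swap_two_three] using this

lemma Within.of_mul {n : ℕ} {τ m : Equiv.Perm (Fin 6)}
    (hm : ∀ σ ε' t' p' q' r', ∃ ε t p q r,
      Commute (ofData σ ε' t' p' q' r') (ofData (σ * m) ε t p q r))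
    (h : Within n (τ * m)) : Within (n + 1) τ := by
  intro σ ε t p q r ε' t' p' q' r'
  obtain ⟨ε₁, t₁, p₁, q₁, r₁, hc⟩ := hm (σ * τ) ε' t' p' q' r'
  rw [mul_assoc] at hc
  refine (SimpleGraph.edist_triangle (v := vertex (σ * (τ * m)) ε₁ t₁ p₁ q₁ r₁)).trans ?_
  rw [Nat.cast_add, Nat.cast_one]
  exact add_le_add (h ..) (edist_le_one hc.symm)

lemma Within.of_mul_swap_two_five {n : ℕ} {τ : Equiv.Perm (Fin 6)}
    (h : Within n (τ * Equiv.swap 2 5)) : Within (n + 1) τ :=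
  h.of_mul fun σ ε t p q r =>
    ⟨ε, t, 0, _, _, commute_ofData_swap_two_five σ p 0 q r fun _ => rfl⟩

lemma Within.of_mul_swap_three_five {n : ℕ} {τ : Equiv.Perm (Fin 6)}
    (h : Within n (τ * Equiv.swap 3 5)) : Within (n + 1) τ :=
  h.of_mul fun σ ε t p q r =>
    ⟨ε, t, _, 0, _, commute_ofData_swap_three_five σ p q 0 r fun _ => rfl⟩

lemma Within.of_mul_swap_four_five {n : ℕ} {τ : Equiv.Perm (Fin 6)}
    (h : Within n (τ * Equiv.swap 4 5)) : Within (n + 1) τ :=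
  h.of_mul fun σ ε t p q r =>
    ⟨ε, t, _, _, 0, commute_ofData_swap_four_five σ p q r 0 fun _ => rfl⟩

lemma Within.of_mul_pairSwap {n : ℕ} {τ : Equiv.Perm (Fin 6)}
    (h : Within n (τ * pairSwap)) : Within (n + 1) τ :=
  h.of_mul fun σ ε t p q r =>
    ⟨1, p - q, t, 0, r, commute_ofData_pairSwap σ r (by simp) (by simp)⟩

lemma Within.of_mul_pairSwap_swap {n : ℕ} {τ : Equiv.Perm (Fin 6)}
    (h : Within n (τ * (pairSwap * Equiv.swap 4 5))) : Within (n + 1) τ :=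
  h.of_mul fun σ ε t p q r =>
    ⟨1, p - q, t, 0, r, commute_ofData_pairSwap_swap σ r r (by simp) (by simp)⟩

lemma neg_ne_self_unit (ε : ℤˣ) : -ε ≠ ε := by
  rcases Int.units_eq_one_or ε with rfl | rfl <;> decide

lemma within_three_oddPair :
    Within 3 (Equiv.swap 3 5 * Equiv.swap 4 5 * Equiv.swap 2 5) := by
  intro σ ε t p q r ε' t' p' q' r'
  have hflip : -ε = ε → t' = t := fun h => absurd h (neg_ne_self_unit ε)
  simp only [← mul_assoc]
  exact edist_le_three (y := vertex _ (-ε) t' p q' r) (z := vertex _ ε' t' p q' r')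
    (commute_ofData_swap_three_five σ p q q' r hflip)
    (commute_ofData_swap_four_five _ p q' r r' fun _ => rfl)
    (commute_ofData_swap_two_five _ p p' q' r' fun _ => rfl)

lemma within_three_halfPair :
    Within 3 (Equiv.swap 3 5 * (pairSwap * Equiv.swap 4 5) * Equiv.swap 4 5) := by
  intro σ ε t p q r ε' t' p' q' r'
  have hflip : -ε = ε → p' - ((-ε : ℤˣ) : ℤ) * q' = t := fun h => absurd h (neg_ne_self_unit ε)
  rw [← mul_assoc, ← mul_assoc]
  exact edist_le_three (y := vertex _ (-ε) (p' - ((-ε : ℤˣ) : ℤ) * q') p 0 r)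
    (z := vertex _ (-ε') p p' q' 0)
    (commute_ofData_swap_three_five σ p q 0 r hflip)
    (commute_ofData_pairSwap_swap _ r 0 rfl (by simp))
    (commute_ofData_swap_four_five _ p' q' 0 r' fun h => absurd h.symm (neg_ne_self_unit ε'))

lemma within_three_posPair :
    Within 3 (pairSwap * Equiv.swap 3 5 * (pairSwap * Equiv.swap 4 5)) := by
  intro σ ε t p q r ε' t' p' q' r'
  have hε := Int.units_coe_mul_self ε'
  simp only [← mul_assoc σ]
  exact edist_le_three (y := vertex _ 1 (p - q) t 0 r)
    (z := vertex _ (-1) (p' + q') t (ε' * (t - t')) r)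
    (commute_ofData_pairSwap σ r (by simp) (by simp))
    (commute_ofData_swap_three_five _ t 0 _ r fun h => absurd h (by decide))
    (commute_ofData_pairSwap_swap _ r r' (by simp) (by linear_combination (t - t') * hε))

lemma within_three_oddPoint :
    Within 3 (pairSwap * Equiv.swap 4 5 * Equiv.swap 3 5 * pairSwap) := by
  intro σ ε t p q r ε' t' p' q' r'
  have hε := Int.units_coe_mul_self ε'
  rw [← mul_assoc, ← mul_assoc]
  exact edist_le_three (y := vertex _ 1 (p - q) t 0 r')
    (z := vertex _ (-1) (p' + q') t (ε' * (t - t')) r')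
    (commute_ofData_pairSwap_swap σ r r' (by simp) (by simp))
    (commute_ofData_swap_three_five _ t 0 _ r' fun h => absurd h (by decide))
    (commute_ofData_pairSwap _ r' (by simp) (by linear_combination (t - t') * hε))

/-- The value tables of some rearrangements that take at most three steps. -/
def threeStep : List (Fin 6 × Fin 6 × Fin 6 × Fin 6 × Fin 6 × Fin 6) :=
  [(0, 1, 4, 5, 3, 2), (0, 1, 4, 5, 2, 3), (2, 5, 0, 1, 4, 3), (3, 5, 0, 1, 4, 2),
   (0, 5, 2, 3, 1, 4), (1, 5, 2, 3, 0, 4), (0, 4, 2, 3, 5, 1), (1, 4, 2, 3, 5, 0)]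

lemma within_of_mem_threeStep {τ : Equiv.Perm (Fin 6)}
    (h : (τ 0, τ 1, τ 2, τ 3, τ 4, τ 5) ∈ threeStep) : Within 3 τ := by
  have key : ∀ ρ : Equiv.Perm (Fin 6), Within 3 ρ →
      (τ 0 = ρ 0 ∧ τ 1 = ρ 1 ∧ τ 2 = ρ 2 ∧ τ 3 = ρ 3 ∧ τ 4 = ρ 4 ∧ τ 5 = ρ 5) → Within 3 τ := by
    rintro ρ hρ ⟨h0, h1, h2, h3, h4, h5⟩
    have : τ = ρ := Equiv.ext fun i => by fin_cases i <;> assumption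
    exact this ▸ hρ
  simp only [threeStep, List.mem_cons, Prod.mk.injEq, List.not_mem_nil, or_false] at h
  rcases h with h | h | h | h | h | h | h | h
  · exact key _ within_three_oddPair h
  · exact key _ within_three_oddPair.mul_left_swap_two_three h
  · exact key _ within_three_halfPair h
  · exact key _ within_three_halfPair.mul_left_swap_two_three h
  · exact key _ within_three_posPair h
  · exact key _ within_three_posPair.mul_left_swap_zero_one h
  · exact key _ within_three_oddPoint h
  · exact key _ within_three_oddPoint.mul_left_swap_zero_one h

/-- Whether `n` moves take the rearrangement with the given values into `threeStep`, up to the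
order of the points in the transposition and of the even negative 1-cycles. -/
def search : ℕ → Fin 6 → Fin 6 → Fin 6 → Fin 6 → Fin 6 → Fin 6 → Bool
  | 0, a, b, c, d, e, f =>
    (threeStep.contains (a, b, c, d, e, f) || threeStep.contains (b, a, c, d, e, f)) ||
    (threeStep.contains (a, b, d, c, e, f) || threeStep.contains (b, a, d, c, e, f))
  | n + 1, a, b, c, d, e, f =>
    search n a b f d e c || search n a b c f e d || search n a b c d f e ||
    search n c d a b e f || search n c d a b f e

lemma within_of_search {n : ℕ} {τ : Equiv.Perm (Fin 6)}
    (h : search n (τ 0) (τ 1) (τ 2) (τ 3) (τ 4) (τ 5) = true) : Within (n + 3) τ := by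
  induction n generalizing τ with
  | zero =>
    rw [zero_add]
    simp only [search, Bool.or_eq_true, List.contains_iff_mem] at h
    rcases h with (h | h) | (h | h)
    · exact within_of_mem_threeStep h
    · exact .of_mul_swap_zero_one (within_of_mem_threeStep h)
    · exact .of_mul_swap_two_three (within_of_mem_threeStep h)
    · exact .of_mul_swap_zero_one (.of_mul_swap_two_three (within_of_mem_threeStep h))
  | succ n ih =>
    rw [add_right_comm]
    simp only [search, Bool.or_eq_true] at h
    rcases h with (((h | h) | h) | h) | h
    · exact .of_mul_swap_two_five (ih h)
    · exact .of_mul_swap_three_five (ih h)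
    · exact .of_mul_swap_four_five (ih h)
    · exact .of_mul_pairSwap (ih h)
    · exact .of_mul_pairSwap_swap (ih h)

set_option synthInstance.maxSize 1000 in
set_option synthInstance.maxHeartbeats 200000 in
lemma search_three : ∀ a b : Fin 6, a ≠ b → ∀ c, c ≠ a → c ≠ b →
    ∀ d, d ≠ a → d ≠ b → d ≠ c → ∀ e, e ≠ a → e ≠ b → e ≠ c → e ≠ d →
    ∀ f, f ≠ a → f ≠ b → f ≠ c → f ≠ d → f ≠ e → search 3 a b c d e f = true := by
  decide +kernel

lemma within_six (τ : Equiv.Perm (Fin 6)) : Within 6 τ := by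
  have h : ∀ i j : Fin 6, i ≠ j → τ i ≠ τ j := fun i j => τ.injective.ne
  apply within_of_search (n := 3)
  apply search_three <;> exact h _ _ (by decide)

end AffineWeylC

/-- For the class of labelled cycle type `(1, 2, 1, 1)` in
`G₆`, the commuting involution graph has diameter at most 6. -/
theorem stmt_18 (a : AffineWeylC 6) (ha : a.Involution)
    (htype : a.HasType 1 2 1 1)
    (X : Set (AffineWeylC 6)) (hX : X = AffineWeylC.conjClass a) :
    (commGraph X).ediam ≤ 6 := by
  obtain ⟨σ, ε, t, p, q, r, rfl⟩ := AffineWeylC.mem_dataSet_of_hasType ha htype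
  rw [AffineWeylC.conjClass_ofData] at hX
  subst hX
  refine SimpleGraph.ediam_le_of_edist_le ?_
  rintro ⟨_, σ, ε, t, p, q, r, rfl⟩ ⟨_, σ', ε', t', p', q', r', rfl⟩
  have h := AffineWeylC.within_six (σ⁻¹ * σ') σ ε t p q r ε' t' p' q' r'
  rwa [mul_inv_cancel_left] at h
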